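/- Let Y = (0,1)², N a positive integer, h = 1/N, and let 𝒯_h be the uniform triangulation of Y consisting of the 2N² triangles obtained by dividing each square [ih,(i+1)h] × [jh,(j+1)h] (0 ≤ i,j ≤ N−1) along the diagonal from (ih,jh) to ((i+1)h,(j+1)h). For 0 < δ ≤ h and K ∈ 𝒯_h let K_δ be the image of K under the homothety with center the barycenter x_K of K and ratio δ/h. For (i,j) ∈ ℤ² let φ^{ij}(x) = max(0, 1 − max(|x₁/h − i|, |x₂/h − j|, |(x₁ − x₂)/h − (i − j)|)), and let I = {1, …, N−1}². Let Q : Y → ℝ be integrable with Q ≥ 0 almost everywhere, and define the stiffness matrix A^Q by A^Q_{ij,kl} = Σ_{K ∈ 𝒯_h} (|K|/|K_δ|) ∫_{K_δ} (∇φ^{ij} · ∇φ^{kl} + Q φ^{ij} φ^{kl}) dx for ij, kl ∈ I. Then A^Q is positive definite: for every nonzero V ∈ ℝ^I, Σ_{ij,kl ∈ I} A^Q_{ij,kl} V_{ij} V_{kl} > 0. In particular, for every F ∈ ℝ^I the linear system A^Q U = F has a unique solution. -/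

import Mathlib

noncomputable section
open MeasureTheory

/-- Closed triangle of the uniform triangulation of the unit square: for
`0 ≤ i, j ≤ N−1`, `tri h i j true` is the lower triangle with vertices
`(ih, jh), ((i+1)h, jh), ((i+1)h, (j+1)h)` and `tri h i j false` the upper triangle
with vertices `(ih, jh), (ih, (j+1)h), ((i+1)h, (j+1)h)`. -/
def tri (h : ℝ) (i j : ℕ) (lower : Bool) : Set (ℝ × ℝ) :=
  if lower then
    convexHull ℝ {((i * h, j * h) : ℝ × ℝ), ((i + 1) * h, j * h), ((i + 1) * h, (j + 1) * h)}
  else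
    convexHull ℝ {((i * h, j * h) : ℝ × ℝ), (i * h, (j + 1) * h), ((i + 1) * h, (j + 1) * h)}

/-- The barycenter of the triangle `tri h i j lower`. -/
def bary (h : ℝ) (i j : ℕ) (lower : Bool) : ℝ × ℝ :=
  if lower then ((3 * i + 2) / 3 * h, (3 * j + 1) / 3 * h)
  else ((3 * i + 1) / 3 * h, (3 * j + 2) / 3 * h)

/-- The patch `K_δ`: the image of the triangle `K = tri h i j lower` under the
homothety with center the barycenter of `K` and ratio `δ/h`. -/
def patch (h δ : ℝ) (i j : ℕ) (lower : Bool) : Set (ℝ × ℝ) :=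
  (AffineMap.homothety (bary h i j lower) (δ / h)) '' (tri h i j lower)

/-- The P1 hat (nodal basis) function at the node `(i h, j h)`. -/
def hat (h : ℝ) (p : ℤ × ℤ) (x : ℝ × ℝ) : ℝ :=
  max 0 (1 - max |x.1 / h - (p.1 : ℝ)|
    (max |x.2 / h - (p.2 : ℝ)| |(x.1 - x.2) / h - ((p.1 : ℝ) - (p.2 : ℝ))|))

/-- Dot product of the gradients of two functions (via the Fréchet derivative; for
piecewise affine functions this is the piecewise constant gradient a.e.). -/
def gradDot (f g : ℝ × ℝ → ℝ) (x : ℝ × ℝ) : ℝ :=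
  fderiv ℝ f x (1, 0) * fderiv ℝ g x (1, 0) + fderiv ℝ f x (0, 1) * fderiv ℝ g x (0, 1)

/-- The HMM stiffness matrix with potential `Q`. -/
def stiff (h δ : ℝ) (N : ℕ) (Q : ℝ × ℝ → ℝ) (p r : ℤ × ℤ) : ℝ :=
  ∑ t : Fin N × Fin N × Bool,
    (volume (tri h t.1 t.2.1 t.2.2)).toReal / (volume (patch h δ t.1 t.2.1 t.2.2)).toReal *
      ∫ x in patch h δ t.1 t.2.1 t.2.2,
        (gradDot (hat h p) (hat h r) x + Q x * hat h p x * hat h r x)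

/-- The interior nodes `I = {1, …, N−1}²`. -/
def nodes (N : ℕ) : Finset (ℤ × ℤ) := Finset.Icc 1 ((N : ℤ) - 1) ×ˢ Finset.Icc 1 ((N : ℤ) - 1)

/-- The unit square `Y = (0,1)²`. -/
def Ysq : Set (ℝ × ℝ) := Set.Ioo (0 : ℝ) 1 ×ˢ Set.Ioo (0 : ℝ) 1

open Set

/-- A quadratic form that is positive on nonzero vectors supported in a finite set `s` gives a
uniquely solvable linear system on `s`. -/
theorem existsUnique_solution_of_pos {ι : Type*} (s : Finset ι) (a : ι → ι → ℝ)
    (ha : ∀ V : ι → ℝ, (∃ i ∈ s, V i ≠ 0) → 0 < ∑ i ∈ s, ∑ k ∈ s, a i k * V i * V k)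
    (F : ι → ℝ) :
    ∃! U : ι → ℝ, (∀ k, k ∉ s → U k = 0) ∧ ∀ i ∈ s, ∑ k ∈ s, a i k * U k = F i := by
  classical
  have eq_zero : ∀ V : ι → ℝ, (∀ i ∈ s, ∑ k ∈ s, a i k * V k = 0) → ∀ i ∈ s, V i = 0 := by
    intro V hV
    by_contra! hne
    refine (ha V hne).ne' (Finset.sum_eq_zero fun i hi => ?_)
    have : ∑ k ∈ s, a i k * V i * V k = V i * ∑ k ∈ s, a i k * V k := by
      rw [Finset.mul_sum]
      exact Finset.sum_congr rfl fun k _ => by ring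
    rw [this, hV i hi, mul_zero]
  let L : (s → ℝ) →ₗ[ℝ] (s → ℝ) := Matrix.mulVecLin (Matrix.of fun i k : s => a i k)
  have hL : ∀ (W : s → ℝ) (i : s), L W i = ∑ k : s, a i k * W k := fun W i => rfl
  have hinj : Function.Injective L := by
    rw [injective_iff_map_eq_zero]
    intro W hW
    have key := eq_zero (fun i => if hi : i ∈ s then W ⟨i, hi⟩ else 0) (fun i hi => by
      have hWi := congrFun hW ⟨i, hi⟩
      rw [hL] at hWi
      rw [← Finset.sum_coe_sort s]
      simpa using hWi)
    funext i
    simpa using key i i.2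
  obtain ⟨W, hW⟩ := (LinearMap.injective_iff_surjective.mp hinj) (fun i : s => F i)
  refine ⟨fun i => if hi : i ∈ s then W ⟨i, hi⟩ else 0, ⟨fun k hk => by simp [hk], ?_⟩, ?_⟩
  · intro i hi
    have hWi := congrFun hW ⟨i, hi⟩
    rw [hL] at hWi
    rw [← Finset.sum_coe_sort s]
    simpa using hWi
  · rintro U ⟨hU0, hU⟩
    funext i
    by_cases hi : i ∈ s
    · have key := eq_zero (fun i => U i - if hi : i ∈ s then W ⟨i, hi⟩ else 0) (fun i hi => by
        have hWi := congrFun hW ⟨i, hi⟩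
        rw [hL] at hWi
        simp only [mul_sub, Finset.sum_sub_distrib, hU i hi]
        rw [← Finset.sum_coe_sort s, sub_eq_zero]
        simpa using hWi.symm)
      simpa [sub_eq_zero] using key i hi
    · simp [hi, hU0 i hi]

theorem exists_lipschitzWith_hat (h : ℝ) (p : ℤ × ℤ) : ∃ C, LipschitzWith C (hat h p) := by
  have aux : ∀ (L : ℝ × ℝ →L[ℝ] ℝ) (a : ℝ), LipschitzWith (‖L‖₊) fun x => |L x - a| := by
    intro L a
    have := (lipschitzWith_one_norm (E := ℝ)).comp (L.lipschitz.sub (LipschitzWith.const a))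
    rw [one_mul, add_zero] at this
    exact this
  let L₁ : ℝ × ℝ →L[ℝ] ℝ := h⁻¹ • ContinuousLinearMap.fst ℝ ℝ ℝ
  let L₂ : ℝ × ℝ →L[ℝ] ℝ := h⁻¹ • ContinuousLinearMap.snd ℝ ℝ ℝ
  have hlip := ((LipschitzWith.const (1 : ℝ)).sub
    ((aux L₁ p.1).max ((aux L₂ p.2).max (aux (L₁ - L₂) ((p.1 : ℝ) - p.2))))).const_max 0
  refine ⟨_, (congrArg (LipschitzWith _) (funext fun x => ?_)).mp hlip⟩
  simp only [hat, L₁, L₂, sub_apply, smul_apply,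
    ContinuousLinearMap.coe_fst', ContinuousLinearMap.coe_snd',
    smul_eq_mul]
  ring_nf

theorem continuous_hat (h : ℝ) (p : ℤ × ℤ) : Continuous (hat h p) :=
  (exists_lipschitzWith_hat h p).choose_spec.continuous

theorem exists_bound_fderiv_hat (h : ℝ) (p : ℤ × ℤ) (e : ℝ × ℝ) :
    ∃ C, ∀ x, ‖fderiv ℝ (hat h p) x e‖ ≤ C := by
  obtain ⟨C, hC⟩ := exists_lipschitzWith_hat h p
  refine ⟨C * ‖e‖, fun x => (ContinuousLinearMap.le_opNorm _ _).trans ?_⟩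
  gcongr
  exact norm_fderiv_le_of_lipschitz ℝ hC

theorem integrableOn_fderiv_hat_mul (h : ℝ) (p r : ℤ × ℤ) (e : ℝ × ℝ) {s : Set (ℝ × ℝ)}
    (hs : volume s ≠ ⊤) :
    IntegrableOn (fun x => fderiv ℝ (hat h p) x e * fderiv ℝ (hat h r) x e) s := by
  obtain ⟨C, hC⟩ := exists_bound_fderiv_hat h p e
  obtain ⟨D, hD⟩ := exists_bound_fderiv_hat h r e
  have : IsFiniteMeasure (volume.restrict s) := isFiniteMeasure_restrict.mpr hs
  exact (Integrable.of_bound (measurable_fderiv_apply_const ℝ _ e).aestronglyMeasurable D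
    (.of_forall hD)).bdd_mul (measurable_fderiv_apply_const ℝ _ e).aestronglyMeasurable
    (.of_forall hC)

theorem integrableOn_gradDot_hat (h : ℝ) (p r : ℤ × ℤ) {s : Set (ℝ × ℝ)} (hs : volume s ≠ ⊤) :
    IntegrableOn (gradDot (hat h p) (hat h r)) s :=
  (integrableOn_fderiv_hat_mul h p r (1, 0) hs).add (integrableOn_fderiv_hat_mul h p r (0, 1) hs)

theorem isCompact_tri (h : ℝ) (i j : ℕ) (b : Bool) : IsCompact (tri h i j b) := by
  unfold tri
  split_ifs <;> exact (Set.toFinite _).isCompact_convexHull ℝ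

theorem isCompact_patch (h δ : ℝ) (i j : ℕ) (b : Bool) : IsCompact (patch h δ i j b) :=
  (isCompact_tri h i j b).image (AffineMap.homothety_continuous _ _)

/-- The image of a convex set under a contracting homothety centred in it stays in the set. -/
theorem Convex.homothety_image_subset {E : Type*} [AddCommGroup E] [Module ℝ E] {s : Set E}
    (hs : Convex ℝ s) {c : E} (hc : c ∈ s) {r : ℝ} (hr0 : 0 ≤ r) (hr1 : r ≤ 1) :
    AffineMap.homothety c r '' s ⊆ s := by
  rintro _ ⟨x, hx, rfl⟩
  rw [AffineMap.homothety_eq_lineMap]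
  exact hs.lineMap_mem hc hx ⟨hr0, hr1⟩

theorem patch_subset_unitSquare {N : ℕ} {h δ : ℝ} (hh : h = 1 / N) (hδ0 : 0 < δ) (hδh : δ ≤ h)
    (i j : Fin N) (b : Bool) : patch h δ i j b ⊆ Icc (0 : ℝ) 1 ×ˢ Icc (0 : ℝ) 1 := by
  have hpos : 0 < h := hδ0.trans_le hδh
  have hNh : N * h = 1 := by
    rw [hh, mul_one_div_cancel]
    rintro h0
    simp [hh, h0] at hpos
  have bound : ∀ k : Fin N, (0 : ℝ) ≤ k * h ∧ (k + 1) * h ≤ 1 := fun k => by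
    refine ⟨by positivity, le_of_le_of_eq ?_ hNh⟩
    gcongr
    exact_mod_cast k.2
  obtain ⟨hi0, hi1⟩ := bound i
  obtain ⟨hj0, hj1⟩ := bound j
  have hconv : Convex ℝ (Icc (0 : ℝ) 1 ×ˢ Icc (0 : ℝ) 1) := (convex_Icc 0 1).prod (convex_Icc 0 1)
  have htri : tri h i j b ⊆ Icc (0 : ℝ) 1 ×ˢ Icc (0 : ℝ) 1 := by
    unfold tri
    split_ifs <;>
    · refine convexHull_min ?_ hconv
      rintro x (rfl | rfl | rfl) <;> refine ⟨⟨?_, ?_⟩, ⟨?_, ?_⟩⟩ <;> dsimp only <;> linarith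
  have hbary : bary h i j b ∈ Icc (0 : ℝ) 1 ×ˢ Icc (0 : ℝ) 1 := by
    unfold bary
    split_ifs <;> refine ⟨⟨?_, ?_⟩, ⟨?_, ?_⟩⟩ <;> dsimp only <;> linarith
  exact (image_mono htri).trans (hconv.homothety_image_subset hbary (by positivity)
    ((div_le_one hpos).mpr hδh))

theorem unitSquare_ae_eq_Ysq :
    (Icc (0 : ℝ) 1 ×ˢ Icc (0 : ℝ) 1 : Set (ℝ × ℝ)) =ᵐ[volume] Ysq :=
  (Measure.set_prod_ae_eq Ioo_ae_eq_Icc Ioo_ae_eq_Icc).symm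

/-- The open lower triangle of the cell `(i, j)`. -/
def openLowerTri (h : ℝ) (i j : ℕ) : Set (ℝ × ℝ) :=
  {x | j * h < x.2 ∧ x.2 - j * h < x.1 - i * h ∧ x.1 < (i + 1) * h}

theorem isOpen_openLowerTri (h : ℝ) (i j : ℕ) : IsOpen (openLowerTri h i j) :=
  (isOpen_lt continuous_const continuous_snd).inter
    ((isOpen_lt (continuous_snd.sub continuous_const) (continuous_fst.sub continuous_const)).inter
      (isOpen_lt continuous_fst continuous_const))

theorem convex_openLowerTri (h : ℝ) (i j : ℕ) : Convex ℝ (openLowerTri h i j) := by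
  rintro ⟨x₁, x₂⟩ ⟨hx₁, hx₂, hx₃⟩ ⟨y₁, y₂⟩ ⟨hy₁, hy₂, hy₃⟩ a b ha hb hab
  have key : ∀ {u v : ℝ}, 0 < u → 0 < v → 0 < a * u + b * v := fun hu hv => by
    rcases ha.eq_or_lt with rfl | ha
    · simpa [(zero_add b).symm.trans hab] using hv
    · positivity
  obtain rfl : b = 1 - a := by linarith
  dsimp only at *
  refine ⟨?_, ?_, ?_⟩ <;> simp only [Prod.smul_mk, Prod.mk_add_mk, smul_eq_mul]
  · linarith [key (sub_pos.mpr hx₁) (sub_pos.mpr hy₁)]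
  · linarith [key (sub_pos.mpr hx₂) (sub_pos.mpr hy₂)]
  · linarith [key (sub_pos.mpr hx₃) (sub_pos.mpr hy₃)]

theorem bary_mem_openLowerTri {h : ℝ} (hh : 0 < h) (i j : ℕ) :
    bary h i j true ∈ openLowerTri h i j := by
  simp only [bary, openLowerTri, if_true, mem_ofPred_eq]
  refine ⟨?_, ?_, ?_⟩ <;> linarith

theorem openLowerTri_subset_tri {h : ℝ} (hh : 0 < h) (i j : ℕ) :
    openLowerTri h i j ⊆ tri h i j true := by
  rintro ⟨x, y⟩ ⟨h₁, h₂, h₃⟩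
  dsimp only at h₁ h₂ h₃
  simp only [tri, if_true]
  let A : ℝ × ℝ := (i * h, j * h)
  let B : ℝ × ℝ := ((i + 1) * h, j * h)
  let C : ℝ × ℝ := ((i + 1) * h, (j + 1) * h)
  let w : Fin 3 → ℝ := ![((i + 1) * h - x) / h, ((x - i * h) - (y - j * h)) / h, (y - j * h) / h]
  have hmem := (convex_convexHull ℝ {A, B, C}).sum_mem (t := Finset.univ) (w := w)
    (z := ![A, B, C])
    (fun k _ => by fin_cases k <;> refine div_nonneg ?_ hh.le <;> linarith)
    (by
      simp only [w, Fin.sum_univ_three, Matrix.cons_val]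
      field_simp
      ring)
    (fun k _ => subset_convexHull ℝ _ (by fin_cases k <;> simp))
  convert! hmem using 1
  simp only [w, A, B, C, Fin.sum_univ_three, Matrix.cons_val, Prod.smul_mk, Prod.mk_add_mk,
    smul_eq_mul, Prod.mk.injEq]
  constructor <;> field_simp <;> ring

/-- The hat function on the reference triangle `0 < t < s < 1`, at the node `(m, n)`. -/
theorem hat_reference {s t : ℝ} (ht : 0 < t) (hts : t < s) (hs : s < 1) (m n : ℤ) :
    max 0 (1 - max |s - m| (max |t - n| |s - t - (m - n)|)) =
      (if m = 0 ∧ n = 0 then 1 - s else 0) + (if m = 1 ∧ n = 0 then s - t else 0) +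
        (if m = 1 ∧ n = 1 then t else 0) := by
  have far : ∀ {u v w : ℝ}, 1 ≤ |u| ∨ 1 ≤ |v| ∨ 1 ≤ |w| →
      max 0 (1 - max |u| (max |v| |w|)) = 0 := fun hu => by
    rw [max_eq_left]
    simpa [le_max_iff] using hu
  rcases (by lia : m ≤ -1 ∨ 2 ≤ m ∨ n ≤ -1 ∨ 2 ≤ n ∨ (m = 0 ∧ n = 1) ∨ (m = 0 ∧ n = 0) ∨
    (m = 1 ∧ n = 0) ∨ (m = 1 ∧ n = 1)) with hm | hm | hn | hn | ⟨rfl, rfl⟩ | ⟨rfl, rfl⟩ |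
      ⟨rfl, rfl⟩ | ⟨rfl, rfl⟩
  · have : (m : ℝ) ≤ -1 := by exact_mod_cast hm
    rw [far (.inl (le_abs.mpr (.inl (by linarith)))), if_neg (by lia), if_neg (by lia),
      if_neg (by lia)]
    simp
  · have : (2 : ℝ) ≤ m := by exact_mod_cast hm
    rw [far (.inl (le_abs.mpr (.inr (by linarith)))), if_neg (by lia), if_neg (by lia),
      if_neg (by lia)]
    simp
  · have : (n : ℝ) ≤ -1 := by exact_mod_cast hn
    rw [far (.inr (.inl (le_abs.mpr (.inl (by linarith))))), if_neg (by lia), if_neg (by lia),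
      if_neg (by lia)]
    simp
  · have : (2 : ℝ) ≤ n := by exact_mod_cast hn
    rw [far (.inr (.inl (le_abs.mpr (.inr (by linarith))))), if_neg (by lia), if_neg (by lia),
      if_neg (by lia)]
    simp
  · rw [far (.inr (.inr (le_abs.mpr (.inl (by push_cast; linarith)))))]
    simp
  · norm_num
    rw [abs_of_pos (by linarith), abs_of_pos ht, abs_of_pos (by linarith),
      max_eq_left (a := s) (max_le (by linarith) (by linarith)), max_eq_right (by linarith)]
  · norm_num
    rw [abs_of_neg (by linarith), abs_of_pos ht, abs_of_neg (by linarith),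
      max_eq_right (a := t) (by linarith), max_eq_right (a := -(s - 1)) (by linarith),
      max_eq_right (by linarith)]
    ring
  · norm_num
    rw [abs_of_neg (by linarith), abs_of_neg (by linarith), abs_of_pos (by linarith),
      max_eq_left (a := -(t - 1)) (by linarith), max_eq_right (a := -(s - 1)) (by linarith),
      max_eq_right (by linarith)]
    ring

theorem hat_eq_of_mem_openLowerTri {h : ℝ} (hh : 0 < h) {i j : ℕ} (p : ℤ × ℤ) {x : ℝ × ℝ}
    (hx : x ∈ openLowerTri h i j) :
    hat h p x = (if p = ((i : ℤ), (j : ℤ)) then 1 - (x.1 / h - i) else 0) +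
      (if p = ((i : ℤ) + 1, (j : ℤ)) then (x.1 / h - i) - (x.2 / h - j) else 0) +
      (if p = ((i : ℤ) + 1, (j : ℤ) + 1) then x.2 / h - j else 0) := by
  obtain ⟨a, b⟩ := p
  obtain ⟨h₁, h₂, h₃⟩ := hx
  have hcancel : ∀ k : ℝ, k = k * h / h := fun k => (mul_div_cancel_right₀ k hh.ne').symm
  have href := hat_reference (s := x.1 / h - i) (t := x.2 / h - j)
    (by rw [hcancel j, ← sub_div]; exact div_pos (by linarith) hh)
    (by rw [hcancel j, hcancel i, ← sub_div, ← sub_div]; gcongr)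
    (by rw [sub_lt_iff_lt_add', div_lt_iff₀ hh]; exact h₃) (a - i) (b - j)
  have hA : (a - i = 0 ∧ b - j = 0) ↔ (a, b) = ((i : ℤ), (j : ℤ)) := by
    rw [Prod.mk.injEq]; lia
  have hB : (a - i = 1 ∧ b - j = 0) ↔ (a, b) = ((i : ℤ) + 1, (j : ℤ)) := by
    rw [Prod.mk.injEq]; lia
  have hC : (a - i = 1 ∧ b - j = 1) ↔ (a, b) = ((i : ℤ) + 1, (j : ℤ) + 1) := by
    rw [Prod.mk.injEq]; lia
  simp only [hA, hB, hC] at href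
  rw [← href]
  simp only [hat]
  push_cast
  ring_nf

theorem fderiv_hat_of_mem_openLowerTri {h : ℝ} (hh : 0 < h) {i j : ℕ} (p : ℤ × ℤ) {x : ℝ × ℝ}
    (hx : x ∈ openLowerTri h i j) :
    fderiv ℝ (hat h p) x (1, 0) = (if p = ((i : ℤ) + 1, (j : ℤ)) then h⁻¹ else 0) -
      (if p = ((i : ℤ), (j : ℤ)) then h⁻¹ else 0) := by
  set α : ℝ := (if p = ((i : ℤ) + 1, (j : ℤ)) then h⁻¹ else 0) -
    (if p = ((i : ℤ), (j : ℤ)) then h⁻¹ else 0) with hα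
  obtain ⟨β, c, haff⟩ : ∃ β c : ℝ, ∀ y ∈ openLowerTri h i j,
      hat h p y = α * y.1 + β * y.2 + c := by
    refine ⟨(if p = ((i : ℤ) + 1, (j : ℤ) + 1) then h⁻¹ else 0) -
        (if p = ((i : ℤ) + 1, (j : ℤ)) then h⁻¹ else 0),
      (if p = ((i : ℤ), (j : ℤ)) then 1 + (i : ℝ) else 0) +
        (if p = ((i : ℤ) + 1, (j : ℤ)) then (j : ℝ) - i else 0) -
        (if p = ((i : ℤ) + 1, (j : ℤ) + 1) then (j : ℝ) else 0), fun y hy => ?_⟩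
    rw [hat_eq_of_mem_openLowerTri hh p hy, hα]
    split_ifs <;> ring
  have hderiv : HasFDerivAt (fun y : ℝ × ℝ => α * y.1 + β * y.2 + c)
      (α • ContinuousLinearMap.fst ℝ ℝ ℝ + β • ContinuousLinearMap.snd ℝ ℝ ℝ) x :=
    ((hasFDerivAt_fst.const_mul α).add (hasFDerivAt_snd.const_mul β)).add_const c
  have heq : hat h p =ᶠ[nhds x] fun y => α * y.1 + β * y.2 + c :=
    Filter.eventuallyEq_of_mem ((isOpen_openLowerTri h i j).mem_nhds hx) haff
  rw [heq.fderiv_eq, hderiv.fderiv]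
  simp

/-- A nonempty open subset of the lower patch that is contained in the open triangle. -/
theorem exists_isOpen_subset_patch {h δ : ℝ} (hδ0 : 0 < δ) (hδh : δ ≤ h) (i j : ℕ) :
    ∃ W, IsOpen W ∧ W.Nonempty ∧ W ⊆ patch h δ i j true ∧ W ⊆ openLowerTri h i j := by
  have hh : 0 < h := hδ0.trans_le hδh
  have hb := bary_mem_openLowerTri hh i j
  exact ⟨AffineMap.homothety (bary h i j true) (δ / h) '' openLowerTri h i j,
    AffineMap.homothety_isOpenMap _ _ (by positivity) _ (isOpen_openLowerTri h i j),
    ⟨_, mem_image_of_mem _ hb⟩, image_mono (openLowerTri_subset_tri hh i j),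
    (convex_openLowerTri h i j).homothety_image_subset hb (by positivity)
      ((div_le_one hh).mpr hδh)⟩

/-- The derivative in the direction `e` of the discrete function with nodal values `V`. -/
def discreteDeriv (h : ℝ) (N : ℕ) (V : ℤ × ℤ → ℝ) (e x : ℝ × ℝ) : ℝ :=
  ∑ p ∈ nodes N, V p * fderiv ℝ (hat h p) x e

/-- The discrete function with nodal values `V`. -/
def discreteFun (h : ℝ) (N : ℕ) (V : ℤ × ℤ → ℝ) (x : ℝ × ℝ) : ℝ :=
  ∑ p ∈ nodes N, V p * hat h p x

/-- The energy density of the discrete function with nodal values `V`. -/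
def energyDensity (h : ℝ) (N : ℕ) (Q : ℝ × ℝ → ℝ) (V : ℤ × ℤ → ℝ) (x : ℝ × ℝ) : ℝ :=
  discreteDeriv h N V (1, 0) x ^ 2 + discreteDeriv h N V (0, 1) x ^ 2 +
    Q x * discreteFun h N V x ^ 2

theorem energyDensity_eq_sum (h : ℝ) (N : ℕ) (Q : ℝ × ℝ → ℝ) (V : ℤ × ℤ → ℝ) (x : ℝ × ℝ) :
    energyDensity h N Q V x = ∑ p ∈ nodes N, ∑ r ∈ nodes N,
      (gradDot (hat h p) (hat h r) x + Q x * hat h p x * hat h r x) * (V p * V r) := by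
  simp only [energyDensity, discreteDeriv, discreteFun, sq, Finset.sum_mul_sum]
  simp only [Finset.mul_sum, ← Finset.sum_add_distrib, gradDot]
  exact Finset.sum_congr rfl fun p _ => Finset.sum_congr rfl fun r _ => by ring

theorem integrableOn_integrand {h : ℝ} {Q : ℝ × ℝ → ℝ} {s : Set (ℝ × ℝ)} (hs : IsCompact s)
    (hQ : IntegrableOn Q s) (p r : ℤ × ℤ) :
    IntegrableOn (fun x => gradDot (hat h p) (hat h r) x + Q x * hat h p x * hat h r x) s :=
  (integrableOn_gradDot_hat h p r hs.measure_ne_top).add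
    ((hQ.mul_continuousOn (continuous_hat h p).continuousOn hs).mul_continuousOn
      (continuous_hat h r).continuousOn hs)

theorem integrableOn_energyDensity {h : ℝ} {N : ℕ} {Q : ℝ × ℝ → ℝ} {s : Set (ℝ × ℝ)}
    (hs : IsCompact s) (hQ : IntegrableOn Q s) (V : ℤ × ℤ → ℝ) :
    IntegrableOn (energyDensity h N Q V) s := by
  rw [funext (energyDensity_eq_sum h N Q V)]
  exact integrable_finsetSum _ fun p _ => integrable_finsetSum _ fun r _ =>
    (integrableOn_integrand hs hQ p r).mul_const _

theorem setIntegral_energyDensity {h : ℝ} {N : ℕ} {Q : ℝ × ℝ → ℝ} {s : Set (ℝ × ℝ)}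
    (hs : IsCompact s) (hQ : IntegrableOn Q s) (V : ℤ × ℤ → ℝ) :
    ∫ x in s, energyDensity h N Q V x = ∑ p ∈ nodes N, ∑ r ∈ nodes N,
      (∫ x in s, (gradDot (hat h p) (hat h r) x + Q x * hat h p x * hat h r x)) * (V p * V r) := by
  simp only [energyDensity_eq_sum]
  rw [integral_finsetSum _ fun p _ => integrable_finsetSum _ fun r _ =>
    (integrableOn_integrand hs hQ p r).mul_const _]
  refine Finset.sum_congr rfl fun p _ => ?_
  rw [integral_finsetSum _ fun r _ => (integrableOn_integrand hs hQ p r).mul_const _]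
  exact Finset.sum_congr rfl fun r _ => integral_mul_const _ _

/-- The quadratic form of the stiffness matrix is the weighted sum of the patch energies. -/
theorem sum_stiff_eq {N : ℕ} {h δ : ℝ} {Q : ℝ × ℝ → ℝ}
    (hQ : ∀ t : Fin N × Fin N × Bool, IntegrableOn Q (patch h δ t.1 t.2.1 t.2.2))
    (V : ℤ × ℤ → ℝ) :
    ∑ p ∈ nodes N, ∑ r ∈ nodes N, stiff h δ N Q p r * V p * V r =
      ∑ t : Fin N × Fin N × Bool,
        (volume (tri h t.1 t.2.1 t.2.2)).toReal / (volume (patch h δ t.1 t.2.1 t.2.2)).toReal *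
          ∫ x in patch h δ t.1 t.2.1 t.2.2, energyDensity h N Q V x := by
  simp only [setIntegral_energyDensity (isCompact_patch h δ _ _ _) (hQ _), Finset.mul_sum]
  refine (Finset.sum_congr rfl fun p _ => ?_).trans Finset.sum_comm
  rw [Finset.sum_comm]
  refine Finset.sum_congr rfl fun r _ => ?_
  simp only [stiff, Finset.sum_mul]
  exact Finset.sum_congr rfl fun t _ => by ring

/-- Nodal values that do not all vanish jump across some horizontal edge. -/
theorem exists_horizontal_jump {N : ℕ} {V : ℤ × ℤ → ℝ} (hV0 : ∀ p ∉ nodes N, V p = 0)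
    (hV : ∃ p ∈ nodes N, V p ≠ 0) :
    ∃ i j : Fin N, V ((i : ℤ) + 1, (j : ℤ)) ≠ V ((i : ℤ), (j : ℤ)) := by
  obtain ⟨⟨a, b⟩, hp, hne⟩ := hV
  by_contra! hall
  simp only [nodes, Finset.mem_product, Finset.mem_Icc] at hp
  lift b to ℕ using by lia
  lift a to ℕ using by lia
  have zero : ∀ k : ℕ, k ≤ N → V ((k : ℤ), (b : ℤ)) = 0 := by
    intro k
    induction k with
    | zero => exact fun _ => hV0 _ (by simp [nodes])
    | succ k ih =>
      intro hk
      have := hall ⟨k, by lia⟩ ⟨b, by lia⟩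
      push_cast
      rw [this]
      exact ih (by lia)
  exact hne (zero a (by lia))

theorem discreteDeriv_of_mem_openLowerTri {N : ℕ} {h : ℝ} (hh : 0 < h) {V : ℤ × ℤ → ℝ}
    (hV0 : ∀ p ∉ nodes N, V p = 0) {i j : ℕ} {x : ℝ × ℝ} (hx : x ∈ openLowerTri h i j) :
    discreteDeriv h N V (1, 0) x =
      (V ((i : ℤ) + 1, (j : ℤ)) - V ((i : ℤ), (j : ℤ))) * h⁻¹ := by
  have pick : ∀ q, ∑ p ∈ nodes N, V p * (if p = q then h⁻¹ else 0) = V q * h⁻¹ := by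
    intro q
    by_cases hq : q ∈ nodes N
    · simp [hq]
    · simp [hq, hV0 q hq]
  simp only [discreteDeriv, fderiv_hat_of_mem_openLowerTri hh _ hx, mul_sub,
    Finset.sum_sub_distrib, pick, sub_mul]

theorem integrableOn_discreteDeriv_sq {N : ℕ} {h : ℝ} {s : Set (ℝ × ℝ)} (hs : IsCompact s)
    (V : ℤ × ℤ → ℝ) (e : ℝ × ℝ) : IntegrableOn (fun x => discreteDeriv h N V e x ^ 2) s := by
  simp only [discreteDeriv, sq, Finset.sum_mul_sum]
  refine integrable_finsetSum _ fun p _ => integrable_finsetSum _ fun r _ => ?_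
  simp only [mul_mul_mul_comm]
  exact (integrableOn_fderiv_hat_mul h p r e hs.measure_ne_top).const_mul _

theorem setIntegral_energyDensity_pos {N : ℕ} {h δ : ℝ} (hδ0 : 0 < δ) (hδh : δ ≤ h)
    {Q : ℝ × ℝ → ℝ} {i j : ℕ} (hQ : IntegrableOn Q (patch h δ i j true))
    (hQpos : ∀ᵐ x ∂volume.restrict (patch h δ i j true), 0 ≤ Q x) {V : ℤ × ℤ → ℝ}
    (hV0 : ∀ p ∉ nodes N, V p = 0) (hV : V ((i : ℤ) + 1, (j : ℤ)) ≠ V ((i : ℤ), (j : ℤ))) :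
    0 < ∫ x in patch h δ i j true, energyDensity h N Q V x := by
  have hh : 0 < h := hδ0.trans_le hδh
  have hcomp := isCompact_patch h δ i j true
  have hint := integrableOn_discreteDeriv_sq (N := N) (h := h) hcomp V (1, 0)
  refine lt_of_lt_of_le ?_ (integral_mono_ae hint (integrableOn_energyDensity hcomp hQ V) ?_)
  · rw [setIntegral_pos_iff_support_of_nonneg_ae (.of_forall fun x => sq_nonneg _) hint]
    obtain ⟨W, hWo, hWne, hWp, hWt⟩ := exists_isOpen_subset_patch hδ0 hδh i j
    refine (hWo.measure_pos volume hWne).trans_le (measure_mono fun x hx => ⟨?_, hWp hx⟩)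
    rw [Function.mem_support, discreteDeriv_of_mem_openLowerTri hh hV0 (hWt hx)]
    exact pow_ne_zero 2 (mul_ne_zero (sub_ne_zero.mpr hV) (inv_ne_zero hh.ne'))
  · filter_upwards [hQpos] with x hx
    simp only [energyDensity]
    nlinarith [sq_nonneg (discreteDeriv h N V (0, 1) x),
      mul_nonneg hx (sq_nonneg (discreteFun h N V x))]

theorem volume_ratio_pos {h δ : ℝ} (hδ0 : 0 < δ) (hδh : δ ≤ h) (i j : ℕ) :
    0 < (volume (tri h i j true)).toReal / (volume (patch h δ i j true)).toReal := by
  have hh : 0 < h := hδ0.trans_le hδh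
  obtain ⟨W, hWo, hWne, hWp, hWt⟩ := exists_isOpen_subset_patch hδ0 hδh i j
  have hW := hWo.measure_pos volume hWne
  exact div_pos
    (ENNReal.toReal_pos (hW.trans_le (measure_mono (hWt.trans (openLowerTri_subset_tri hh i j)))).ne'
      (isCompact_tri h i j true).measure_ne_top)
    (ENNReal.toReal_pos (hW.trans_le (measure_mono hWp)).ne'
      (isCompact_patch h δ i j true).measure_ne_top)

theorem sum_stiff_pos {N : ℕ} {h δ : ℝ} (hδ0 : 0 < δ) (hδh : δ ≤ h) {Q : ℝ × ℝ → ℝ}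
    (hQ : ∀ t : Fin N × Fin N × Bool, IntegrableOn Q (patch h δ t.1 t.2.1 t.2.2))
    (hQpos : ∀ t : Fin N × Fin N × Bool,
      ∀ᵐ x ∂volume.restrict (patch h δ t.1 t.2.1 t.2.2), 0 ≤ Q x)
    {V : ℤ × ℤ → ℝ} (hV0 : ∀ p ∉ nodes N, V p = 0) (hV : ∃ p ∈ nodes N, V p ≠ 0) :
    0 < ∑ p ∈ nodes N, ∑ r ∈ nodes N, stiff h δ N Q p r * V p * V r := by
  obtain ⟨i, j, hij⟩ := exists_horizontal_jump hV0 hV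
  rw [sum_stiff_eq hQ]
  refine Finset.sum_pos' (fun t _ => mul_nonneg (by positivity) ?_)
    ⟨(i, j, true), Finset.mem_univ _, mul_pos (volume_ratio_pos hδ0 hδh i j)
      (setIntegral_energyDensity_pos hδ0 hδh (hQ (i, j, true)) (hQpos (i, j, true)) hV0 hij)⟩
  refine integral_nonneg_of_ae ?_
  filter_upwards [hQpos t] with x hx
  simp only [energyDensity, Pi.zero_apply]
  positivity

/-- Positive definiteness of the HMM stiffness matrix with
nonnegative integrable potential `Q`, and unique solvability of the discrete system
`A^Q U = F` (with the zero-extension convention for coordinates outside `I`). -/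
theorem stmt12 (N : ℕ) (hN : 0 < N) (h δ : ℝ) (hh : h = 1 / N)
    (hδ0 : 0 < δ) (hδh : δ ≤ h)
    (Q : ℝ × ℝ → ℝ) (hQint : IntegrableOn Q Ysq)
    (hQpos : ∀ᵐ x ∂(volume.restrict Ysq), 0 ≤ Q x) :
    (∀ V : ℤ × ℤ → ℝ, (∃ ij ∈ nodes N, V ij ≠ 0) →
      0 < ∑ ij ∈ nodes N, ∑ kl ∈ nodes N, stiff h δ N Q ij kl * V ij * V kl) ∧
    (∀ F : ℤ × ℤ → ℝ, ∃! U : ℤ × ℤ → ℝ,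
      (∀ kl, kl ∉ nodes N → U kl = 0) ∧
      (∀ ij ∈ nodes N, ∑ kl ∈ nodes N, stiff h δ N Q ij kl * U kl = F ij)) := by
  have hsub := fun t : Fin N × Fin N × Bool =>
    patch_subset_unitSquare hh hδ0 hδh t.1 t.2.1 t.2.2
  have hQ := (hQint.congr_set_ae unitSquare_ae_eq_Ysq)
  rw [← Measure.restrict_congr_set unitSquare_ae_eq_Ysq] at hQpos
  have pos : ∀ V : ℤ × ℤ → ℝ, (∃ ij ∈ nodes N, V ij ≠ 0) →
      0 < ∑ ij ∈ nodes N, ∑ kl ∈ nodes N, stiff h δ N Q ij kl * V ij * V kl := by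
    rintro V ⟨q, hq, hne⟩
    have key := sum_stiff_pos hδ0 hδh (fun t => hQ.mono_set (hsub t))
      (fun t => ae_restrict_of_ae_restrict_of_subset (hsub t) hQpos)
      (V := fun p => if p ∈ nodes N then V p else 0) (fun p hp => if_neg hp)
      ⟨q, hq, by simpa [hq] using hne⟩
    refine key.trans_eq (Finset.sum_congr rfl fun p hp => Finset.sum_congr rfl fun r hr => ?_)
    rw [if_pos hp, if_pos hr]
  exact ⟨pos, existsUnique_solution_of_pos (nodes N) (stiff h δ N Q) pos⟩
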